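/- Let n ≥ 2 and let G ⊆ U(n) be a finite subgroup. Define the eigenvalue counting function N_G(λ) = Σ over pairs of natural numbers (p,q) with 0 < 2q(p+n−1) ≤ λ of dim_ℂ H_{p,q}^G. Then lim_{λ→∞} N_G(λ)/λ^n = (Vol(S^{2n−1})/|G|) · ((n−1)/(n·(2π)^n·Γ(n+1))) · ∫_{−∞}^{∞} (τ/sinh τ)^n e^{−(n−2)τ} dτ, where Vol(S^{2n−1}) = 2π^n/Γ(n) is the (2n−1)-dimensional volume of the unit sphere in ℂ^n. -/

import Mathlib

noncomputable section

open MvPolynomial Matrix Complex Real Filter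

/-- Variables: `Sum.inl i` is `z i`, `Sum.inr i` is `conj (z i)`. -/
abbrev Var (n : ℕ) := Fin n ⊕ Fin n

/-- Bidegree weight: `z`-variables have weight (1,0), `z̄`-variables weight (0,1). -/
def bidegWt (n : ℕ) : Var n → ℕ × ℕ :=
  Sum.elim (fun _ => ((1 : ℕ), (0 : ℕ))) (fun _ => ((0 : ℕ), (1 : ℕ)))

/-- The Laplacian `∑ i, ∂²/∂zᵢ∂z̄ᵢ` on polynomials in `z, z̄`. -/
def kohnLap (n : ℕ) : MvPolynomial (Var n) ℂ →ₗ[ℂ] MvPolynomial (Var n) ℂ :=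
  ∑ i : Fin n, ((pderiv (R := ℂ) (Sum.inl i)).toLinearMap.comp
    (pderiv (R := ℂ) (Sum.inr i)).toLinearMap)

/-- `H_{p,q}`: harmonic polynomials on ℂⁿ of bidegree `(p,q)`. -/
def Hpq (n p q : ℕ) : Submodule ℂ (MvPolynomial (Var n) ℂ) :=
  (weightedHomogeneousSubmodule ℂ (bidegWt n) (p, q)) ⊓ (LinearMap.ker (kohnLap n))

/-- The action of a unitary matrix `g` on polynomials, `(g · f)(z) = f(g⁻¹ z)`:
substitution `zᵢ ↦ ∑ⱼ (g⁻¹)ᵢⱼ zⱼ`, `z̄ᵢ ↦ ∑ⱼ conj((g⁻¹)ᵢⱼ) z̄ⱼ`. -/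
def uAct (n : ℕ) (g : Matrix.unitaryGroup (Fin n) ℂ) :
    MvPolynomial (Var n) ℂ →ₐ[ℂ] MvPolynomial (Var n) ℂ :=
  aeval (Sum.elim
    (fun i => ∑ j : Fin n,
      MvPolynomial.C ((g⁻¹ : Matrix.unitaryGroup (Fin n) ℂ) i j) * X (Sum.inl j))
    (fun i => ∑ j : Fin n,
      MvPolynomial.C ((starRingEnd ℂ) ((g⁻¹ : Matrix.unitaryGroup (Fin n) ℂ) i j)) * X (Sum.inr j)))

/-- `H_{p,q}^S`: the subspace of `H_{p,q}` invariant under every element of `S`. -/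
def HpqInv (n p q : ℕ) (S : Set (Matrix.unitaryGroup (Fin n) ℂ)) :
    Submodule ℂ (MvPolynomial (Var n) ℂ) :=
  Hpq n p q ⊓ (⨅ g ∈ S, LinearMap.ker ((uAct n g).toLinearMap - LinearMap.id))

/-- `dim_ℂ H_{p,q}^S`. -/
def dimHpqInv (n p q : ℕ) (S : Set (Matrix.unitaryGroup (Fin n) ℂ)) : ℕ :=
  Module.finrank ℂ (HpqInv n p q S)

/-- A set of unitary matrices acts freely on the sphere iff no element other than
the identity has `1` as an eigenvalue. -/
def actsFreely {n : ℕ} (S : Set (Matrix.unitaryGroup (Fin n) ℂ)) : Prop :=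
  ∀ g ∈ S, ((g : Matrix (Fin n) (Fin n) ℂ) - 1).det = 0 → g = 1

/-- The eigenvalue counting function `N_G(λ)`: the number of positive eigenvalues
`2q(p+n-1) ≤ λ` of the Kohn Laplacian on `G\S^{2n-1}`, with multiplicity. -/
def countN (n : ℕ) (S : Set (Matrix.unitaryGroup (Fin n) ℂ)) (lam : ℝ) : ℕ :=
  ∑ pq ∈ (Finset.range (⌊lam⌋₊ + 1) ×ˢ Finset.range (⌊lam⌋₊ + 1)).filter
      (fun pq => 0 < 2 * pq.2 * (pq.1 + n - 1) ∧ ((2 * pq.2 * (pq.1 + n - 1) : ℕ) : ℝ) ≤ lam),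
    dimHpqInv n pq.1 pq.2 S

/-- The geometric power series `∑ aᵐ Xᵐ = 1 / (1 - a X)`. -/
def geomSeries (a : ℂ) : PowerSeries ℂ := PowerSeries.mk fun m => a ^ m

/-- The complete homogeneous symmetric polynomial of degree `m` evaluated at the multiset `s`. -/
def completeHom (s : Multiset ℂ) (m : ℕ) : ℂ :=
  PowerSeries.coeff m (s.map geomSeries).prod

theorem geomSeries_eq (a : ℂ) :
    geomSeries a = 1 + PowerSeries.C a * (PowerSeries.X * geomSeries a) := by
  ext m
  cases m with
  | zero => simp [geomSeries]
  | succ m =>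
    simp [geomSeries, PowerSeries.coeff_succ_X_mul, pow_succ', PowerSeries.coeff_one]

theorem completeHom_zero (s : Multiset ℂ) : completeHom s 0 = 1 := by
  induction s using Multiset.induction_on with
  | empty => simp [completeHom]
  | cons a s ih =>
    simp only [completeHom, PowerSeries.coeff_zero_eq_constantCoeff, Multiset.map_cons,
      Multiset.prod_cons, map_mul] at ih ⊢
    rw [ih]
    simp [geomSeries, ← PowerSeries.coeff_zero_eq_constantCoeff_apply]

theorem completeHom_cons_succ (a : ℂ) (s : Multiset ℂ) (m : ℕ) :
    completeHom (a ::ₘ s) (m + 1) = completeHom s (m + 1) + a * completeHom (a ::ₘ s) m := by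
  simp only [completeHom, Multiset.map_cons, Multiset.prod_cons]
  conv_lhs => rw [geomSeries_eq, add_mul, one_mul, mul_assoc, mul_assoc]
  rw [map_add, PowerSeries.coeff_C_mul, PowerSeries.coeff_succ_X_mul]

theorem completeHom_one_cons (s : Multiset ℂ) (m : ℕ) :
    completeHom (1 ::ₘ s) m = ∑ j ∈ Finset.range (m + 1), completeHom s j := by
  induction m with
  | zero => simp [completeHom_zero]
  | succ m ih => rw [completeHom_cons_succ, Finset.sum_range_succ, ← ih]; ring

theorem norm_completeHom_le {k : ℕ} {s : Multiset ℂ} (hs : s.card = k + 1)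
    (h1 : ∀ a ∈ s, ‖a‖ ≤ 1) (m : ℕ) : ‖completeHom s m‖ ≤ (m + 1 : ℝ) ^ k := by
  induction k generalizing s m with
  | zero =>
    obtain ⟨a, rfl⟩ := Multiset.card_eq_one.1 hs
    have : completeHom {a} m = a ^ m := by simp [completeHom, geomSeries]
    rw [this, norm_pow, pow_zero]
    exact pow_le_one₀ (norm_nonneg _) (h1 a (by simp))
  | succ k ih =>
    obtain ⟨a, ha⟩ := Multiset.card_pos_iff_exists_mem.1 (by omega : 0 < s.card)
    obtain ⟨t, rfl⟩ := Multiset.exists_cons_of_mem ha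
    rw [Multiset.card_cons] at hs
    have h2 : ∀ b ∈ t, ‖b‖ ≤ 1 := fun b hb => h1 b (Multiset.mem_cons_of_mem hb)
    replace ha : ‖a‖ ≤ 1 := h1 a (Multiset.mem_cons_self _ _)
    clear h1
    induction m with
    | zero => simp [completeHom_zero]
    | succ m ihm =>
      rw [completeHom_cons_succ]
      have e1 := ih (by omega) h2 (m + 1)
      have e2 : ‖a * completeHom (a ::ₘ t) m‖ ≤ (m + 1 : ℝ) ^ (k + 1) := by
        rw [norm_mul]
        calc _ ≤ 1 * _ := mul_le_mul_of_nonneg_right ha (norm_nonneg _)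
          _ ≤ _ := by rw [one_mul]; exact ihm
      refine (norm_add_le _ _).trans ((add_le_add e1 e2).trans ?_)
      have e3 : (m + 1 : ℝ) ^ k ≤ (m + 1 + 1 : ℝ) ^ k :=
        pow_le_pow_left₀ (by positivity) (by linarith) _
      have e4 : (0 : ℝ) ≤ (m : ℝ) + 1 := by positivity
      push_cast
      rw [pow_succ, pow_succ]
      nlinarith

theorem completeHom_replicate_one (k m : ℕ) :
    completeHom (Multiset.replicate (k + 1) 1) m = ((m + k).choose k : ℕ) := by
  have h : geomSeries 1 = PowerSeries.mk 1 := by ext; simp [geomSeries]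
  rw [completeHom, Multiset.map_replicate, Multiset.prod_replicate, h,
    PowerSeries.mk_one_pow_eq_mk_choose_add, PowerSeries.coeff_mk, add_comm]

theorem sub_mul_completeHom (a b : ℂ) (s : Multiset ℂ) (m : ℕ) :
    (a - b) * completeHom (a ::ₘ b ::ₘ s) m =
      completeHom (a ::ₘ s) (m + 1) - completeHom (b ::ₘ s) (m + 1) := by
  have h1 := completeHom_cons_succ a (b ::ₘ s) m
  have h2 := completeHom_cons_succ b (a ::ₘ s) m
  rw [Multiset.cons_swap] at h2
  linear_combination h2 - h1

theorem norm_completeHom_le_of_ne {k : ℕ} {a b : ℂ} (hab : a ≠ b) {s : Multiset ℂ}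
    (hs : s.card = k) (h1 : ∀ c ∈ a ::ₘ b ::ₘ s, ‖c‖ ≤ 1) (m : ℕ) :
    ‖completeHom (a ::ₘ b ::ₘ s) m‖ ≤ 2 / ‖a - b‖ * (m + 2 : ℝ) ^ k := by
  have hpos : 0 < ‖a - b‖ := norm_pos_iff.2 (sub_ne_zero.2 hab)
  have e := congrArg norm (sub_mul_completeHom a b s m)
  rw [norm_mul] at e
  have b1 := norm_completeHom_le (s := a ::ₘ s) (k := k) (by simp [hs])
    (fun c hc => h1 c (by simp at hc ⊢; tauto)) (m + 1)
  have b2 := norm_completeHom_le (s := b ::ₘ s) (k := k) (by simp [hs])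
    (fun c hc => h1 c (by simp at hc ⊢; tauto)) (m + 1)
  have b3 := norm_sub_le (completeHom (a ::ₘ s) (m + 1)) (completeHom (b ::ₘ s) (m + 1))
  push_cast at b1 b2
  rw [show (m : ℝ) + 1 + 1 = m + 2 by ring] at b1 b2
  rw [div_mul_eq_mul_div, le_div_iff₀ hpos]
  linarith

/-- The growth rate of the partial sums of `completeHom s`. -/
theorem tendsto_completeHom_one_cons {n : ℕ} (hn : 1 ≤ n) {s : Multiset ℂ} (hs : s.card = n)
    (h1 : ∀ a ∈ s, ‖a‖ ≤ 1) :
    Tendsto (fun m : ℕ => completeHom (1 ::ₘ s) m / (m : ℂ) ^ n) atTop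
      (nhds (if ∀ a ∈ s, a = 1 then 1 / (n.factorial : ℂ) else 0)) := by
  split_ifs with h
  · have hs' : 1 ::ₘ s = Multiset.replicate (n + 1) 1 := by
      rw [Multiset.replicate_succ, Multiset.eq_replicate.2 ⟨hs, h⟩]
    have key : Tendsto (fun m : ℕ => (((m + n).choose n : ℕ) : ℝ) / (m : ℝ) ^ n) atTop
        (nhds (1 / (n.factorial : ℝ))) := by
      have e : ∀ m : ℕ, (((m + n).choose n : ℕ) : ℝ) =
          (∏ i ∈ Finset.range n, ((m : ℝ) + (1 + i))) / n.factorial := fun m => by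
        rw [eq_div_iff (by positivity), ← Nat.cast_mul, mul_comm,
          ← Nat.ascFactorial_eq_factorial_mul_choose, Nat.ascFactorial_eq_prod_range]
        push_cast
        exact Finset.prod_congr rfl fun i _ => by ring
      have lim : Tendsto (fun m : ℕ => (∏ i ∈ Finset.range n, (1 + (1 + (i : ℝ)) / (m : ℝ))) /
          n.factorial) atTop (nhds ((∏ i ∈ Finset.range n, (1 + (0 : ℝ))) / n.factorial)) :=
        (tendsto_finsetProd _ fun i _ => tendsto_const_nhds.add
          (tendsto_const_div_atTop_nhds_zero_nat _)).div_const _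
      rw [Finset.prod_eq_one (fun _ _ => by simp)] at lim
      refine lim.congr' ?_
      filter_upwards [eventually_gt_atTop 0] with m hm
      have hm' : (m : ℝ) ≠ 0 := by exact_mod_cast hm.ne'
      rw [e, div_right_comm]
      congr 1
      have pw : (m : ℝ) ^ n = ∏ _i ∈ Finset.range n, (m : ℝ) := by simp
      rw [eq_div_iff (by positivity), pw, ← Finset.prod_mul_distrib]
      exact Finset.prod_congr rfl fun i _ => by field_simp
    have := (Complex.continuous_ofReal.tendsto _).comp key
    simp only [hs', completeHom_replicate_one]
    refine (this.congr fun m => ?_).trans (by simp)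
    simp
  · push Not at h
    obtain ⟨b, hb, hb1⟩ := h
    obtain ⟨t, rfl⟩ := Multiset.exists_cons_of_mem hb
    obtain ⟨k, rfl⟩ : ∃ k, n = k + 1 := ⟨n - 1, by omega⟩
    rw [Multiset.card_cons] at hs
    have hle := norm_completeHom_le_of_ne (k := k) (Ne.symm hb1) (s := t) (by omega)
      (fun c hc => by
        rcases Multiset.mem_cons.1 hc with rfl | hc
        · simp
        · exact h1 c hc)
    have lim : Tendsto (fun m : ℕ => 2 / ‖1 - b‖ * (1 + 2 / (m : ℝ)) ^ k * (1 / (m : ℝ))) atTop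
        (nhds (2 / ‖1 - b‖ * (1 + 0) ^ k * 0)) := by
      refine Tendsto.mul (Tendsto.const_mul _ (Tendsto.pow (tendsto_const_nhds.add ?_) _)) ?_
      · exact tendsto_const_div_atTop_nhds_zero_nat 2
      · exact tendsto_const_div_atTop_nhds_zero_nat 1
    rw [mul_zero] at lim
    refine squeeze_zero_norm' ?_ lim
    filter_upwards [eventually_gt_atTop 0] with m hm
    have hm' : (0 : ℝ) < m := by exact_mod_cast hm
    rw [norm_div, norm_pow, Complex.norm_natCast, div_le_iff₀ (by positivity)]
    refine (hle m).trans (le_of_eq ?_)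
    rw [show (1 + 2 / (m : ℝ)) = (m + 2) / m by field_simp, div_pow, pow_succ]
    field_simp

theorem tendsto_natDiv_sub_div (v f : ℕ) :
    Tendsto (fun K : ℕ => ((K / v - f : ℕ) : ℝ) / K) atTop (nhds (1 / v)) := by
  rcases Nat.eq_zero_or_pos v with rfl | hv
  · simp
  have hv' : (0 : ℝ) < v := by exact_mod_cast hv
  have lim : Tendsto (fun K : ℕ => 1 / (v : ℝ) - (1 + f) / (K : ℝ)) atTop
      (nhds (1 / v - 0)) := tendsto_const_nhds.sub (tendsto_const_div_atTop_nhds_zero_nat _)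
  rw [sub_zero] at lim
  refine tendsto_of_tendsto_of_tendsto_of_le_of_le' lim tendsto_const_nhds ?_ ?_
  · filter_upwards [eventually_gt_atTop 0] with K hK
    have hK' : (0 : ℝ) < K := by exact_mod_cast hK
    have h1 : (K : ℝ) / v < (K / v : ℕ) + 1 := by
      rw [div_lt_iff₀ hv']
      exact_mod_cast Nat.lt_div_mul_add hv |>.trans_eq (by ring)
    have h2 : ((K / v : ℕ) : ℝ) ≤ (K / v - f : ℕ) + f := by
      exact_mod_cast (by omega : K / v ≤ K / v - f + f)
    rw [le_div_iff₀ hK', sub_mul, div_mul_cancel₀ _ hK'.ne', one_div_mul_eq_div]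
    linarith
  · filter_upwards [eventually_gt_atTop 0] with K hK
    have hK' : (0 : ℝ) < K := by exact_mod_cast hK
    rw [div_le_iff₀ hK', one_div_mul_eq_div]
    exact (Nat.cast_le.2 (Nat.sub_le _ _)).trans Nat.cast_div_le

/-- A dominated convergence statement for weighted sums over a hyperbolic region. -/
theorem tendsto_tsum_hyperbola {k e f : ℕ} (he : 1 ≤ e) (hf : 1 ≤ f) {C : ℝ} {w H : ℕ → ℂ} {L : ℂ}
    (hw : ∀ j, ‖w j‖ ≤ C * (j + 1 : ℝ) ^ k) (hH : ∀ m, ‖H m‖ ≤ (m + 1 : ℝ) ^ (k + 2))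
    (hL : Tendsto (fun m : ℕ => H m / (m : ℂ) ^ (k + 2)) atTop (nhds L)) :
    Tendsto (fun K : ℕ => (∑' j : ℕ, if f ≤ K / (2 * (j + e)) then
        w j * H (K / (2 * (j + e)) - f) else 0) / (K : ℂ) ^ (k + 2)) atTop
      (nhds (∑' j : ℕ, w j * (L * (1 / ((2 * (j + e) : ℕ) : ℂ)) ^ (k + 2)))) := by
  have hC : 0 ≤ C := by simpa using (norm_nonneg _).trans (hw 0)
  simp_rw [← tsum_div_const]
  have hsum : Summable fun j : ℕ => C * (1 / ((j : ℝ) + 1) ^ 2) := by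
    refine Summable.mul_left _ ?_
    have := (summable_nat_add_iff 1).2 (Real.summable_one_div_nat_pow.2 (one_lt_two : 1 < 2))
    simpa using this
  refine tendsto_tsum_of_dominated_convergence hsum (fun j => ?_) ?_
  · have hv : 0 < 2 * (j + e) := by omega
    have lim := tendsto_natDiv_sub_div (2 * (j + e)) f
    have hdiv : Tendsto (fun K : ℕ => K / (2 * (j + e))) atTop atTop :=
      Nat.tendsto_div_const_atTop hv.ne'
    have hsub : Tendsto (fun K : ℕ => K / (2 * (j + e)) - f) atTop atTop :=
      (tendsto_sub_atTop_nat f).comp hdiv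
    have limC := (Complex.continuous_ofReal.tendsto _).comp lim
    have := ((hL.comp hsub).mul (limC.pow (k + 2))).const_mul (w j)
    refine (this.congr' ?_).trans (by simp)
    filter_upwards [hdiv.eventually_ge_atTop f, hsub.eventually_gt_atTop 0,
      eventually_gt_atTop 0] with K h1 h2 h3
    have h2' : ((K / (2 * (j + e)) - f : ℕ) : ℂ) ≠ 0 := by exact_mod_cast h2.ne'
    have h3' : (K : ℂ) ≠ 0 := by exact_mod_cast h3.ne'
    simp only [Function.comp, if_pos h1, Complex.ofReal_div, Complex.ofReal_natCast, div_pow]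
    field_simp
  · filter_upwards [eventually_gt_atTop 0] with K hK j
    have hK' : (0 : ℝ) < K := by exact_mod_cast hK
    have hj : (0 : ℝ) < (j : ℝ) + 1 := by positivity
    split_ifs with h
    · have h1 : ‖H (K / (2 * (j + e)) - f)‖ ≤ ((K : ℝ) / (j + 1)) ^ (k + 2) := by
        refine (hH _).trans (pow_le_pow_left₀ (by positivity) ?_ _)
        have a1 : ((K / (2 * (j + e)) - f : ℕ) : ℝ) + 1 ≤ (K / (j + 1) : ℕ) := by
          have : K / (2 * (j + e)) ≤ K / (j + 1) := Nat.div_le_div_left (by omega) (by omega)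
          exact_mod_cast (by omega : K / (2 * (j + e)) - f + 1 ≤ K / (j + 1))
        refine a1.trans (Nat.cast_div_le.trans_eq (by push_cast; rfl))
      rw [norm_div, norm_mul, norm_pow, Complex.norm_natCast, div_le_iff₀ (by positivity)]
      refine (mul_le_mul (hw j) h1 (norm_nonneg _) (by positivity)).trans (le_of_eq ?_)
      rw [div_pow, pow_add _ k 2, pow_add _ k 2]
      field_simp
    · rw [zero_div, norm_zero]
      positivity

theorem sum_hyperbola_eq_tsum {e f : ℕ} (he : 1 ≤ e) (hf : 1 ≤ f) (x y : ℕ → ℂ) (K : ℕ) :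
    (∑ i ∈ Finset.range (K + 1), ∑ j ∈ Finset.range (K + 1),
      if 2 * (j + e) * (i + f) ≤ K then x i * y j else 0) =
    ∑' j : ℕ, if f ≤ K / (2 * (j + e)) then
      y j * ∑ i ∈ Finset.range (K / (2 * (j + e)) - f + 1), x i else 0 := by
  have iff (i j : ℕ) : 2 * (j + e) * (i + f) ≤ K ↔ i + f ≤ K / (2 * (j + e)) := by
    rw [Nat.le_div_iff_mul_le (by omega), mul_comm]
  rw [tsum_eq_sum (s := Finset.range (K + 1)), Finset.sum_comm]
  · refine Finset.sum_congr rfl fun j _ => ?_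
    simp only [iff]
    have hle : K / (2 * (j + e)) ≤ K := Nat.div_le_self _ _
    split_ifs with h
    · rw [← Finset.sum_filter, Finset.mul_sum]
      refine Finset.sum_congr ?_ fun i _ => mul_comm _ _
      ext i
      simp only [Finset.mem_filter, Finset.mem_range]
      omega
    · exact Finset.sum_eq_zero fun i _ => if_neg (by omega)
  · intro j hj
    rw [Finset.mem_range, not_lt] at hj
    rw [if_neg]
    rw [Nat.div_eq_of_lt (by omega)]
    omega

/-- The contribution of a diagonalizable element with eigenvalues `s` to the counting function. -/
def traceHpq (s t : Multiset ℂ) (p q : ℕ) : ℂ :=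
  completeHom s p * completeHom t q -
    if p = 0 ∨ q = 0 then 0 else completeHom s (p - 1) * completeHom t (q - 1)

theorem traceHpq_cons (u v : ℂ) (huv : u * v = 1) (s t : Multiset ℂ) (i j : ℕ) :
    traceHpq (u ::ₘ s) (v ::ₘ t) i (j + 1) =
      completeHom (u ::ₘ s) i * completeHom t (j + 1) +
        v * (completeHom s i * completeHom (v ::ₘ t) j) := by
  cases i with
  | zero =>
    simp only [traceHpq, completeHom_zero, completeHom_cons_succ v t j, true_or, if_true]
    ring
  | succ i =>
    simp only [traceHpq, completeHom_cons_succ]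
    rw [if_neg (by omega)]
    simp only [Nat.add_sub_cancel]
    linear_combination (completeHom (u ::ₘ s) i * completeHom (v ::ₘ t) j) * huv

theorem tendsto_sum_traceHpq {k : ℕ} {u v : ℂ} (huv : u * v = 1) {s t : Multiset ℂ}
    (hs : s.card = k + 1) (ht : t.card = k + 1) (hs1 : ∀ a ∈ u ::ₘ s, ‖a‖ ≤ 1)
    (ht1 : ∀ a ∈ v ::ₘ t, ‖a‖ ≤ 1) :
    Tendsto (fun K : ℕ => (∑ i ∈ Finset.range (K + 1), ∑ j ∈ Finset.range (K + 1),
        if 2 * (j + 1) * (i + (k + 1)) ≤ K then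
          traceHpq (u ::ₘ s) (v ::ₘ t) i (j + 1) else 0) / (K : ℂ) ^ (k + 2)) atTop
      (nhds ((∑' j : ℕ, completeHom t (j + 1) *
          ((if ∀ a ∈ u ::ₘ s, a = 1 then 1 / ((k + 2).factorial : ℂ) else 0) *
            (1 / ((2 * (j + 1) : ℕ) : ℂ)) ^ (k + 2))) +
        v * ∑' j : ℕ, completeHom s j *
          ((if ∀ a ∈ v ::ₘ t, a = 1 then 1 / ((k + 2).factorial : ℂ) else 0) *
            (1 / ((2 * (j + (k + 1)) : ℕ) : ℂ)) ^ (k + 2)))) := by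
  have key (K : ℕ) : (∑ i ∈ Finset.range (K + 1), ∑ j ∈ Finset.range (K + 1),
        if 2 * (j + 1) * (i + (k + 1)) ≤ K then
          traceHpq (u ::ₘ s) (v ::ₘ t) i (j + 1) else 0) =
      (∑' j : ℕ, if k + 1 ≤ K / (2 * (j + 1)) then
        completeHom t (j + 1) * completeHom (1 ::ₘ u ::ₘ s) (K / (2 * (j + 1)) - (k + 1)) else 0) +
      v * ∑' j : ℕ, if 1 ≤ K / (2 * (j + (k + 1))) then
        completeHom s j * completeHom (1 ::ₘ v ::ₘ t) (K / (2 * (j + (k + 1))) - 1) else 0 := by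
    simp only [completeHom_one_cons]
    rw [← sum_hyperbola_eq_tsum le_rfl (by omega) _ (fun j => completeHom t (j + 1)),
      ← sum_hyperbola_eq_tsum (by omega) le_rfl _ (fun j => completeHom s j), Finset.mul_sum,
      Finset.sum_comm (s := Finset.range (K + 1))
        (f := fun i j => if 2 * (j + 1) * (i + (k + 1)) ≤ K then
          completeHom (u ::ₘ s) i * completeHom t (j + 1) else 0),
      ← Finset.sum_add_distrib, Finset.sum_comm]
    refine Finset.sum_congr rfl fun j _ => ?_
    rw [Finset.mul_sum, ← Finset.sum_add_distrib]
    refine Finset.sum_congr rfl fun i _ => ?_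
    have hc : 2 * (i + (k + 1)) * (j + 1) = 2 * (j + 1) * (i + (k + 1)) := by ring
    rw [hc]
    split_ifs
    · rw [traceHpq_cons u v huv]; ring
    · simp
  simp_rw [key, add_div, mul_div_assoc]
  have hcons (a : ℂ) (r : Multiset ℂ) (hr : r.card = k + 1) (hr1 : ∀ b ∈ a ::ₘ r, ‖b‖ ≤ 1) (m) :
      ‖completeHom (1 ::ₘ a ::ₘ r) m‖ ≤ (m + 1 : ℝ) ^ (k + 2) :=
    norm_completeHom_le (by simp [hr]) (fun b hb => by
      rcases Multiset.mem_cons.1 hb with rfl | hb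
      · simp
      · exact hr1 b hb) m
  have hs2 := norm_completeHom_le hs fun a ha => hs1 a (Multiset.mem_cons_of_mem ha)
  have ht2 := norm_completeHom_le ht fun a ha => ht1 a (Multiset.mem_cons_of_mem ha)
  refine (tendsto_tsum_hyperbola (C := 2 ^ k) le_rfl (by omega) (fun j => ?_) (hcons u s hs hs1)
    (tendsto_completeHom_one_cons (by omega) (by simp [hs]) hs1)).add
    ((tendsto_tsum_hyperbola (C := 1) (by omega) le_rfl (fun j => ?_) (hcons v t ht ht1)
      (tendsto_completeHom_one_cons (by omega) (by simp [ht]) ht1)).const_mul v)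
  · refine (ht2 (j + 1)).trans ?_
    rw [← mul_pow]
    refine pow_le_pow_left₀ (by positivity) ?_ _
    push_cast
    linarith [(Nat.cast_nonneg j : (0 : ℝ) ≤ j)]
  · rw [one_mul]
    exact hs2 j

open MeasureTheory in
theorem integral_pow_mul_exp_neg_mul_Ioi (k : ℕ) {c : ℝ} (hc : 0 < c) :
    ∫ x in Set.Ioi (0 : ℝ), x ^ k * Real.exp (-(c * x)) = k.factorial / c ^ (k + 1) := by
  have key := Real.integral_rpow_mul_exp_neg_mul_Ioi (a := k + 1) (by positivity) hc
  rw [add_sub_cancel_right, Real.Gamma_nat_eq_factorial] at key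
  simp only [Real.rpow_natCast] at key
  rw [key]
  norm_cast
  rw [one_div, inv_pow]
  field_simp

theorem summable_choose_div_pow (k b : ℕ) (hb : 1 ≤ b) :
    Summable fun i : ℕ => ((i + (k + 1)).choose (k + 1) : ℝ) / ((i + b : ℕ) : ℝ) ^ (k + 3) := by
  have hsum : Summable fun j : ℕ => 1 / ((j : ℝ) + 1) ^ 2 := by
    have := (summable_nat_add_iff 1).2 (Real.summable_one_div_nat_pow.2 (one_lt_two : 1 < 2))
    simpa using this
  refine hsum.of_nonneg_of_le (fun i => by positivity) fun i => ?_
  have h1 : ((i + (k + 1)).choose (k + 1) : ℝ) ≤ (i + 1 : ℝ) ^ (k + 1) := by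
    have := norm_completeHom_le (s := Multiset.replicate (k + 2) 1) (k := k + 1) (by simp)
      (fun a ha => by simp [Multiset.eq_of_mem_replicate ha]) i
    rwa [completeHom_replicate_one, Complex.norm_natCast] at this
  have h2 : ((i : ℝ) + 1) ^ (k + 3) ≤ ((i + b : ℕ) : ℝ) ^ (k + 3) :=
    pow_le_pow_left₀ (by positivity) (by exact_mod_cast (by omega : i + 1 ≤ i + b)) _
  calc _ ≤ (i + 1 : ℝ) ^ (k + 1) / (i + 1 : ℝ) ^ (k + 3) := by gcongr
    _ = _ := by rw [pow_add _ (k + 1) 2]; field_simp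

theorem div_sinh_pow_mul_exp_hasSum (k b : ℕ) {x : ℝ} (hx : 0 < x) :
    HasSum (fun i : ℕ => 2 ^ (k + 2) * ((i + (k + 1)).choose (k + 1) : ℝ) *
        (x ^ (k + 2) * Real.exp (-(2 * ((i + b : ℕ) : ℝ) * x))))
      ((x / Real.sinh x) ^ (k + 2) * Real.exp (-(2 * b - (k + 2)) * x)) := by
  have hr : ‖Real.exp (-(2 * x))‖ < 1 := by
    rw [Real.norm_of_nonneg (Real.exp_pos _).le, Real.exp_lt_one_iff]; linarith
  have h := (hasSum_choose_mul_geometric_of_norm_lt_one (k + 1) hr).mul_left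
    (2 ^ (k + 2) * x ^ (k + 2) * Real.exp (-(2 * b * x)))
  have hterm (i : ℕ) : 2 ^ (k + 2) * ((i + (k + 1)).choose (k + 1) : ℝ) *
        (x ^ (k + 2) * Real.exp (-(2 * ((i + b : ℕ) : ℝ) * x))) =
      2 ^ (k + 2) * x ^ (k + 2) * Real.exp (-(2 * b * x)) *
        (((i + (k + 1)).choose (k + 1) : ℝ) * Real.exp (-(2 * x)) ^ i) := by
    rw [← Real.exp_nat_mul]
    have : Real.exp (-(2 * ((i + b : ℕ) : ℝ) * x)) =
        Real.exp (-(2 * b * x)) * Real.exp (i * -(2 * x)) := by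
      rw [← Real.exp_add]; congr 1; push_cast; ring
    rw [this]; ring
  have hval : (x / Real.sinh x) ^ (k + 2) * Real.exp (-(2 * b - (k + 2)) * x) =
      2 ^ (k + 2) * x ^ (k + 2) * Real.exp (-(2 * b * x)) *
        (1 / (1 - Real.exp (-(2 * x))) ^ (k + 1 + 1)) := by
    have hs : Real.sinh x = Real.exp x * (1 - Real.exp (-(2 * x))) / 2 := by
      rw [Real.sinh_eq, mul_sub, ← Real.exp_add]; ring_nf
    have he : Real.exp (-(2 * b - (k + 2)) * x) =
        Real.exp (-(2 * b * x)) * Real.exp x ^ (k + 2) := by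
      rw [← Real.exp_nat_mul, ← Real.exp_add]; congr 1; push_cast; ring
    have h1 : 1 - Real.exp (-(2 * x)) ≠ 0 := by
      rw [Real.norm_of_nonneg (Real.exp_pos _).le] at hr; linarith
    have h2 := Real.exp_ne_zero x
    rw [hs, he, div_pow, div_pow, mul_pow]
    field_simp
  simp_rw [hterm, hval]
  exact h

open MeasureTheory in
theorem integral_div_sinh_pow_Ioi (k b : ℕ) (hb : 1 ≤ b) :
    ∫ x in Set.Ioi (0 : ℝ), (x / Real.sinh x) ^ (k + 2) * Real.exp (-(2 * b - (k + 2)) * x) =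
      (k + 2).factorial / 2 *
        ∑' i : ℕ, ((i + (k + 1)).choose (k + 1) : ℝ) / ((i + b : ℕ) : ℝ) ^ (k + 3) := by
  set F : ℕ → ℝ → ℝ := fun i x => 2 ^ (k + 2) * ((i + (k + 1)).choose (k + 1) : ℝ) *
        (x ^ (k + 2) * Real.exp (-(2 * ((i + b : ℕ) : ℝ) * x))) with hF
  have hc (i : ℕ) : (0 : ℝ) < 2 * ((i + b : ℕ) : ℝ) := by
    have : (0 : ℝ) < ((i + b : ℕ) : ℝ) := by exact_mod_cast (by omega : 0 < i + b)
    positivity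
  have h_term (i : ℕ) : ∫ x in Set.Ioi (0 : ℝ), F i x = (k + 2).factorial / 2 *
      (((i + (k + 1)).choose (k + 1) : ℝ) / ((i + b : ℕ) : ℝ) ^ (k + 3)) := by
    have := hc i
    simp only [hF]
    rw [integral_const_mul, integral_pow_mul_exp_neg_mul_Ioi _ (hc i), mul_pow]
    field_simp
    ring
  have hch (i : ℕ) : (0 : ℝ) < ((i + (k + 1)).choose (k + 1) : ℝ) := by
    exact_mod_cast Nat.choose_pos (by omega)
  have hI (i : ℕ) : Integrable (F i) (volume.restrict (Set.Ioi 0)) := by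
    refine .of_integral_ne_zero ?_
    rw [h_term]
    have := hc i
    have := hch i
    have : (0 : ℝ) < ((i + b : ℕ) : ℝ) := by linarith
    positivity
  have hnorm (i : ℕ) : ∫ x in Set.Ioi (0 : ℝ), ‖F i x‖ = ∫ x in Set.Ioi (0 : ℝ), F i x := by
    refine setIntegral_congr_fun measurableSet_Ioi fun x hx => Real.norm_of_nonneg ?_
    have : (0 : ℝ) < x := hx
    simp only [hF]
    positivity
  have hS := (summable_choose_div_pow k b hb).mul_left ((k + 2).factorial / 2 : ℝ)
  have := (hasSum_integral_of_summable_integral_norm hI (by simpa only [hnorm, h_term] using hS))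
  rw [setIntegral_congr_fun (g := fun x => ∑' i, F i x) measurableSet_Ioi
    fun x hx => (div_sinh_pow_mul_exp_hasSum k b hx).tsum_eq.symm, ← this.tsum_eq]
  simp only [h_term, tsum_mul_left]

open MeasureTheory in
theorem integral_div_sinh_pow (k : ℕ) :
    ∫ x : ℝ, (x / Real.sinh x) ^ (k + 2) * Real.exp (-(k : ℝ) * x) =
      (k + 2).factorial / (2 * (k + 1)) *
        ((∑' j : ℕ, ((j + 1 + k).choose k : ℝ) / ((j + 1 : ℕ) : ℝ) ^ (k + 2)) +
          ∑' j : ℕ, ((j + k).choose k : ℝ) / ((j + (k + 1) : ℕ) : ℝ) ^ (k + 2)) := by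
  set f : ℝ → ℝ := fun x => (x / Real.sinh x) ^ (k + 2) * Real.exp (-(k : ℝ) * x) with hf
  have e1 : ∫ x in Set.Ioi (0 : ℝ), f x = _ :=
    (integral_congr_ae (.of_forall fun x => by
      simp only [hf]; push_cast; ring_nf)).trans (integral_div_sinh_pow_Ioi k (k + 1) (by omega))
  have e2 : ∫ x in Set.Ioi (0 : ℝ), f (-x) = _ :=
    (integral_congr_ae (.of_forall fun x => by
      simp only [hf, Real.sinh_neg, neg_div_neg_eq]; push_cast; ring_nf)).trans
        (integral_div_sinh_pow_Ioi k 1 le_rfl)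
  have hpos (b : ℕ) (hb : 1 ≤ b) : 0 < ∑' i : ℕ, ((i + (k + 1)).choose (k + 1) : ℝ) /
      ((i + b : ℕ) : ℝ) ^ (k + 3) := by
    refine (summable_choose_div_pow k b hb).tsum_pos (fun i => by positivity) 0 ?_
    have : (0 : ℝ) < ((0 + b : ℕ) : ℝ) := by exact_mod_cast (by omega : 0 < 0 + b)
    simp only [zero_add, Nat.choose_self] at *
    positivity
  have i1 : IntegrableOn f (Set.Ioi 0) := .of_integral_ne_zero (by
    rw [e1]; have := hpos (k + 1) (by omega); positivity)
  have e3 : ∫ x in Set.Iic (0 : ℝ), f x = ∫ x in Set.Ioi (0 : ℝ), f (-x) := by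
    simp [integral_comp_neg_Ioi 0 f]
  have i2 : IntegrableOn f (Set.Iic 0) := .of_integral_ne_zero (by
    rw [e3, e2]; have := hpos 1 le_rfl; positivity)
  rw [← intervalIntegral.integral_Iic_add_Ioi i2 i1, e3, e2, e1]
  have s1 (j : ℕ) : ((j + 1 + k).choose k : ℝ) / ((j + 1 : ℕ) : ℝ) ^ (k + 2) =
      (k + 1) * (((j + (k + 1)).choose (k + 1) : ℝ) / ((j + 1 : ℕ) : ℝ) ^ (k + 3)) := by
    have h := Nat.choose_succ_right_eq (j + 1 + k) k
    rw [Nat.add_sub_cancel] at h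
    have h' : ((j + (k + 1)).choose (k + 1) : ℝ) * (k + 1) =
        ((j + 1 + k).choose k : ℝ) * ((j + 1 : ℕ) : ℝ) := by
      rw [show j + (k + 1) = j + 1 + k by ring]
      exact_mod_cast h
    have hj : ((j + 1 : ℕ) : ℝ) ≠ 0 := by positivity
    rw [div_eq_iff (by positivity), ← mul_div_assoc, mul_comm ((k : ℝ) + 1), h',
      pow_succ _ (k + 2)]
    field_simp
  have s2 (j : ℕ) : ((j + k).choose k : ℝ) / ((j + (k + 1) : ℕ) : ℝ) ^ (k + 2) =
      (k + 1) * (((j + (k + 1)).choose (k + 1) : ℝ) / ((j + (k + 1) : ℕ) : ℝ) ^ (k + 3)) := by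
    have h := Nat.add_one_mul_choose_eq (j + k) k
    have h' : ((j + (k + 1)).choose (k + 1) : ℝ) * (k + 1) =
        ((j + k).choose k : ℝ) * ((j + (k + 1) : ℕ) : ℝ) := by
      rw [← add_assoc, mul_comm (((j + k).choose k : ℕ) : ℝ)]
      exact_mod_cast h.symm
    have hj : ((j + (k + 1) : ℕ) : ℝ) ≠ 0 := by positivity
    rw [div_eq_iff (by positivity), ← mul_div_assoc, mul_comm ((k : ℝ) + 1), h',
      pow_succ _ (k + 2)]
    field_simp
  simp only [s1, s2, tsum_mul_left]
  field_simp

/-- A complex matrix of finite order is diagonalizable, with eigenvalues of modulus one. -/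
theorem exists_diagonalization {n m : ℕ} (hm : 0 < m) {A : Matrix (Fin n) (Fin n) ℂ}
    (hA : A ^ m = 1) :
    ∃ (P Q : Matrix (Fin n) (Fin n) ℂ) (μ : Fin n → ℂ), P * Q = 1 ∧ Q * P = 1 ∧
      A = P * Matrix.diagonal μ * Q ∧ ∀ i, ‖μ i‖ = 1 := by
  set f : Module.End ℂ (Fin n → ℂ) := Matrix.toLin' A with hf
  have hfm : f ^ m = 1 := by rw [hf, ← Matrix.toLin'_pow, hA, Matrix.toLin'_one]; rfl
  have hss : f.IsSemisimple := by
    refine Module.End.isSemisimple_of_squarefree_aeval_eq_zero (p := Polynomial.X ^ m - 1)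
      (Polynomial.X_pow_sub_one_separable_iff.2 (by exact_mod_cast hm.ne')).squarefree ?_
    simp [hfm]
  classical
  have h_internal : DirectSum.IsInternal fun μ : ℂ => f.eigenspace μ :=
    DirectSum.isInternal_submodule_of_iSupIndep_of_iSup_eq_top
      f.eigenspaces_iSupIndep hss.iSup_eigenspace_eq_top
  let b := h_internal.collectedBasis fun μ => Module.finBasis ℂ (f.eigenspace μ)
  have : Fintype (Σ μ : ℂ, Fin (Module.finrank ℂ (f.eigenspace μ))) :=
    FiniteDimensional.fintypeBasisIndex b
  have hcard : Fintype.card (Σ μ : ℂ, Fin (Module.finrank ℂ (f.eigenspace μ))) = n := by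
    rw [← Module.finrank_eq_card_basis b, Module.finrank_fin_fun]
  let e := Fintype.equivFinOfCardEq hcard
  let c := b.reindex e
  let μ : Fin n → ℂ := fun i => (e.symm i).1
  have hc (i : Fin n) : f (c i) = μ i • c i := by
    have : c i ∈ f.eigenspace (μ i) := by
      simp only [c, Module.Basis.reindex_apply]
      exact h_internal.collectedBasis_mem _ _
    exact Module.End.mem_eigenspace_iff.1 this
  have hcm (i : Fin n) (l : ℕ) : (f ^ l) (c i) = μ i ^ l • c i := by
    induction l with
    | zero => simp
    | succ l ih => rw [pow_succ', Module.End.mul_apply, ih, map_smul, hc, smul_smul, pow_succ]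
  let s := Pi.basisFun ℂ (Fin n)
  refine ⟨s.toMatrix c, c.toMatrix s, μ, s.toMatrix_mul_toMatrix_flip c,
    c.toMatrix_mul_toMatrix_flip s, ?_, fun i => ?_⟩
  · have h1 : Matrix.diagonal μ = LinearMap.toMatrix c c f := by
      ext i j
      rw [LinearMap.toMatrix_apply, hc, map_smul, Finsupp.smul_apply, Module.Basis.repr_self,
        Matrix.diagonal_apply, Finsupp.single_apply]
      by_cases h : i = j
      · simp [h]
      · simp [h, Ne.symm h]
    rw [h1, basis_toMatrix_mul_linearMap_toMatrix_mul_basis_toMatrix, hf]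
    exact (LinearMap.toMatrix'_toLin' A).symm
  · have h := hcm i m
    rw [hfm, Module.End.one_apply] at h
    have : μ i ^ m = 1 := by
      have h2 : (μ i ^ m - 1) • c i = 0 := by rw [sub_smul, ← h, one_smul, sub_self]
      exact sub_eq_zero.1 ((smul_eq_zero.1 h2).resolve_right (c.ne_zero i))
    exact norm_eq_one_of_pow_eq_one this hm.ne'

/-- The substitution `zᵢ ↦ ∑ⱼ Aᵢⱼ zⱼ`, `z̄ᵢ ↦ ∑ⱼ Bᵢⱼ z̄ⱼ`. -/
def linSubst {n : ℕ} (A B : Matrix (Fin n) (Fin n) ℂ) :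
    MvPolynomial (Var n) ℂ →ₐ[ℂ] MvPolynomial (Var n) ℂ :=
  aeval (Sum.elim (fun i => ∑ j : Fin n, MvPolynomial.C (A i j) * X (Sum.inl j))
    (fun i => ∑ j : Fin n, MvPolynomial.C (B i j) * X (Sum.inr j)))

section linSubst

variable {n : ℕ}

theorem uAct_eq_linSubst (g : Matrix.unitaryGroup (Fin n) ℂ) :
    uAct n g = linSubst ((g⁻¹ : Matrix.unitaryGroup (Fin n) ℂ) : Matrix (Fin n) (Fin n) ℂ)
      (((g⁻¹ : Matrix.unitaryGroup (Fin n) ℂ) : Matrix (Fin n) (Fin n) ℂ).map (starRingEnd ℂ)) :=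
  rfl

@[simp]
theorem linSubst_X_inl (A B : Matrix (Fin n) (Fin n) ℂ) (i : Fin n) :
    linSubst A B (X (Sum.inl i)) = ∑ j, MvPolynomial.C (A i j) * X (Sum.inl j) := by
  simp [linSubst]

@[simp]
theorem linSubst_X_inr (A B : Matrix (Fin n) (Fin n) ℂ) (i : Fin n) :
    linSubst A B (X (Sum.inr i)) = ∑ j, MvPolynomial.C (B i j) * X (Sum.inr j) := by
  simp [linSubst]

theorem linSubst_comp (A B A' B' : Matrix (Fin n) (Fin n) ℂ) :
    (linSubst A B).comp (linSubst A' B') = linSubst (A' * A) (B' * B) := by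
  refine MvPolynomial.algHom_ext fun i => ?_
  have hC (r : ℂ) : linSubst A B (MvPolynomial.C r) = MvPolynomial.C r := (linSubst A B).commutes r
  rcases i with i | i <;>
  · simp only [AlgHom.comp_apply, linSubst_X_inl, linSubst_X_inr, map_sum, map_mul, hC,
      Finset.mul_sum, Matrix.mul_apply, Finset.sum_mul]
    rw [Finset.sum_comm]
    simp only [mul_assoc]

theorem linSubst_one : linSubst (1 : Matrix (Fin n) (Fin n) ℂ) 1 = AlgHom.id ℂ _ := by
  refine MvPolynomial.algHom_ext fun i => ?_
  rcases i with i | i <;>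
    simp [Matrix.one_apply, apply_ite (MvPolynomial.C (σ := Var n))]

theorem isWeightedHomogeneous_linSubst (A B : Matrix (Fin n) (Fin n) ℂ) {m : ℕ × ℕ}
    {f : MvPolynomial (Var n) ℂ} (hf : f.IsWeightedHomogeneous (bidegWt n) m) :
    (linSubst A B f).IsWeightedHomogeneous (bidegWt n) m := by
  have hX (i : Var n) : (linSubst A B (X i)).IsWeightedHomogeneous (bidegWt n) (bidegWt n i) := by
    rcases i with i | i
    · rw [linSubst_X_inl]
      exact IsWeightedHomogeneous.sum _ _ _ fun j _ =>
        (isWeightedHomogeneous_X ℂ (bidegWt n) (Sum.inl j)).C_mul _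
    · rw [linSubst_X_inr]
      exact IsWeightedHomogeneous.sum _ _ _ fun j _ =>
        (isWeightedHomogeneous_X ℂ (bidegWt n) (Sum.inr j)).C_mul _
  rw [f.as_sum, map_sum]
  refine IsWeightedHomogeneous.sum _ _ _ fun d hd => ?_
  have hd' := hf (mem_support_iff.1 hd)
  have hC (r : ℂ) : linSubst A B (MvPolynomial.C r) = MvPolynomial.C r := (linSubst A B).commutes r
  rw [monomial_eq, map_mul, hC, Finsupp.prod, map_prod, ← hd', Finsupp.weight_apply, Finsupp.sum]
  refine (IsWeightedHomogeneous.prod _ _ _ fun i _ => ?_).C_mul _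
  rw [map_pow]
  exact (hX i).pow _

theorem pderiv_inl_linSubst (A B : Matrix (Fin n) (Fin n) ℂ) (j : Fin n)
    (f : MvPolynomial (Var n) ℂ) :
    pderiv (Sum.inl j) (linSubst A B f) =
      ∑ i, MvPolynomial.C (A i j) * linSubst A B (pderiv (Sum.inl i) f) := by
  induction f using MvPolynomial.induction_on with
  | C a =>
    have : linSubst A B (MvPolynomial.C a) = MvPolynomial.C a := (linSubst A B).commutes a
    simp [this]
  | add p q hp hq => simp only [map_add, hp, hq, mul_add, Finset.sum_add_distrib]
  | mul_X p l hp =>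
    simp only [map_mul, Derivation.leibniz, hp, smul_eq_mul, map_add, mul_add,
      Finset.sum_add_distrib]
    congr 1
    · rcases l with l | l
      · simp [pderiv_X, Pi.single_apply, apply_ite (linSubst A B), mul_comm]
      · simp [pderiv_X]
    · rw [Finset.mul_sum]
      exact Finset.sum_congr rfl fun i _ => by ring

theorem pderiv_inr_linSubst (A B : Matrix (Fin n) (Fin n) ℂ) (j : Fin n)
    (f : MvPolynomial (Var n) ℂ) :
    pderiv (Sum.inr j) (linSubst A B f) =
      ∑ i, MvPolynomial.C (B i j) * linSubst A B (pderiv (Sum.inr i) f) := by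
  induction f using MvPolynomial.induction_on with
  | C a =>
    have : linSubst A B (MvPolynomial.C a) = MvPolynomial.C a := (linSubst A B).commutes a
    simp [this]
  | add p q hp hq => simp only [map_add, hp, hq, mul_add, Finset.sum_add_distrib]
  | mul_X p l hp =>
    simp only [map_mul, Derivation.leibniz, hp, smul_eq_mul, map_add, mul_add,
      Finset.sum_add_distrib]
    congr 1
    · rcases l with l | l
      · simp [pderiv_X]
      · simp [pderiv_X, Pi.single_apply, apply_ite (linSubst A B), mul_comm]
    · rw [Finset.mul_sum]
      exact Finset.sum_congr rfl fun i _ => by ring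

theorem kohnLap_apply (f : MvPolynomial (Var n) ℂ) :
    kohnLap n f = ∑ i, pderiv (Sum.inl i) (pderiv (Sum.inr i) f) := by
  simp [kohnLap]

theorem kohnLap_linSubst {A B : Matrix (Fin n) (Fin n) ℂ} (hAB : A * Bᵀ = 1)
    (f : MvPolynomial (Var n) ℂ) :
    kohnLap n (linSubst A B f) = linSubst A B (kohnLap n f) := by
  simp only [kohnLap_apply, pderiv_inr_linSubst, map_sum, Derivation.leibniz, pderiv_C,
    mul_zero, add_zero, smul_eq_mul, pderiv_inl_linSubst, Finset.mul_sum]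
  rw [Finset.sum_comm]
  refine Finset.sum_congr rfl fun i _ => ?_
  rw [Finset.sum_comm]
  have h (l : Fin n) : ∑ j, MvPolynomial.C (σ := Var n) (B i j) * (MvPolynomial.C (A l j) *
        linSubst A B (pderiv (Sum.inl l) (pderiv (Sum.inr i) f))) =
      if l = i then linSubst A B (pderiv (Sum.inl l) (pderiv (Sum.inr i) f)) else 0 := by
    have := congrFun (congrFun hAB l) i
    rw [Matrix.mul_apply, Matrix.one_apply] at this
    simp_rw [← mul_assoc, ← Finset.sum_mul, ← map_mul, ← map_sum, mul_comm (B i _)]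
    simp only [Matrix.transpose_apply] at this
    rw [this]
    split_ifs <;> simp
  simp only [h, Finset.sum_ite_eq', Finset.mem_univ, if_true]

theorem kohnLap_uAct (g : Matrix.unitaryGroup (Fin n) ℂ) (f : MvPolynomial (Var n) ℂ) :
    kohnLap n (uAct n g f) = uAct n g (kohnLap n f) := by
  rw [uAct_eq_linSubst]
  refine kohnLap_linSubst ?_ f
  exact (Matrix.mem_unitaryGroup_iff.1 (g⁻¹).2)

theorem uAct_uAct (g h : Matrix.unitaryGroup (Fin n) ℂ) (f : MvPolynomial (Var n) ℂ) :
    uAct n g (uAct n h f) = uAct n (g * h) f := by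
  rw [← AlgHom.comp_apply]
  simp only [uAct_eq_linSubst]
  rw [linSubst_comp, ← Matrix.map_mul, _root_.mul_inv_rev]
  rfl

theorem uAct_one : uAct n 1 = AlgHom.id ℂ _ := by
  rw [uAct_eq_linSubst, inv_one]
  simp [linSubst_one]

end linSubst

section Bidegree

variable {n : ℕ}

theorem weight_bidegWt (d : Var n →₀ ℕ) :
    Finsupp.weight (bidegWt n) d = (∑ i, d (Sum.inl i), ∑ i, d (Sum.inr i)) := by
  rw [Finsupp.weight_apply, Finsupp.sum_fintype _ _ (by simp), Fintype.sum_sum_type]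
  ext <;> simp [bidegWt, Prod.fst_sum, Prod.snd_sum]

theorem isWeightedHomogeneous_kohnLap {p q : ℕ} {f : MvPolynomial (Var n) ℂ}
    (hf : f.IsWeightedHomogeneous (bidegWt n) (p + 1, q + 1)) :
    (kohnLap n f).IsWeightedHomogeneous (bidegWt n) (p, q) := by
  rw [kohnLap_apply]
  refine IsWeightedHomogeneous.sum _ _ _ fun i _ => ?_
  exact (hf.pderiv (n' := (p + 1, q)) (i := Sum.inr i) (by simp [bidegWt])).pderiv
    (by simp [bidegWt])

theorem pderiv_inl_eq_zero {q : ℕ} {f : MvPolynomial (Var n) ℂ}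
    (hf : f.IsWeightedHomogeneous (bidegWt n) (0, q)) (i : Fin n) :
    pderiv (Sum.inl i) f = 0 := by
  refine pderiv_eq_zero_of_notMem_vars fun h => ?_
  obtain ⟨d, hd, hid⟩ := (mem_vars_iff_mem_support _).1 h
  have h1 := hf (mem_support_iff.1 hd)
  rw [weight_bidegWt, Prod.mk.injEq, Finset.sum_eq_zero_iff] at h1
  exact Finsupp.mem_support_iff.1 hid (h1.1 i (Finset.mem_univ i))

theorem pderiv_inr_eq_zero {p : ℕ} {f : MvPolynomial (Var n) ℂ}
    (hf : f.IsWeightedHomogeneous (bidegWt n) (p, 0)) (i : Fin n) :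
    pderiv (Sum.inr i) f = 0 := by
  refine pderiv_eq_zero_of_notMem_vars fun h => ?_
  obtain ⟨d, hd, hid⟩ := (mem_vars_iff_mem_support _).1 h
  have h1 := hf (mem_support_iff.1 hd)
  rw [weight_bidegWt, Prod.mk.injEq, Finset.sum_eq_zero_iff] at h1
  exact Finsupp.mem_support_iff.1 hid (h1.2 i (Finset.mem_univ i))

theorem kohnLap_eq_zero {p q : ℕ} (hpq : p = 0 ∨ q = 0) {f : MvPolynomial (Var n) ℂ}
    (hf : f.IsWeightedHomogeneous (bidegWt n) (p, q)) : kohnLap n f = 0 := by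
  rw [kohnLap_apply]
  refine Finset.sum_eq_zero fun i _ => ?_
  rcases hpq with rfl | rfl
  · rcases q with _ | q
    · rw [pderiv_inr_eq_zero hf, map_zero]
    · exact pderiv_inl_eq_zero (hf.pderiv (n' := (0, q)) (by simp [bidegWt])) i
  · rw [pderiv_inr_eq_zero hf, map_zero]

theorem sum_X_inl_mul_pderiv {p q : ℕ} {f : MvPolynomial (Var n) ℂ}
    (hf : f.IsWeightedHomogeneous (bidegWt n) (p, q)) :
    ∑ i, X (Sum.inl i) * pderiv (Sum.inl i) f = p • f := by
  have h : f.IsWeightedHomogeneous (fun i => (bidegWt n i).1) p := fun d hd => by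
    have := congrArg Prod.fst (hf hd)
    rwa [Finsupp.weight_apply, Finsupp.sum, Prod.fst_sum] at this
  have := h.sum_weight_X_mul_pderiv
  rw [Fintype.sum_sum_type] at this
  simpa [bidegWt] using this

theorem sum_X_inr_mul_pderiv {p q : ℕ} {f : MvPolynomial (Var n) ℂ}
    (hf : f.IsWeightedHomogeneous (bidegWt n) (p, q)) :
    ∑ i, X (Sum.inr i) * pderiv (Sum.inr i) f = q • f := by
  have h : f.IsWeightedHomogeneous (fun i => (bidegWt n i).2) q := fun d hd => by
    have := congrArg Prod.snd (hf hd)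
    rwa [Finsupp.weight_apply, Finsupp.sum, Prod.snd_sum] at this
  have := h.sum_weight_X_mul_pderiv
  rw [Fintype.sum_sum_type] at this
  simpa [bidegWt] using this

/-- The squared norm `∑ zᵢ z̄ᵢ` as a polynomial. -/
def normSqPoly (n : ℕ) : MvPolynomial (Var n) ℂ :=
  ∑ i : Fin n, X (Sum.inl i) * X (Sum.inr i)

theorem isWeightedHomogeneous_normSqPoly :
    (normSqPoly n).IsWeightedHomogeneous (bidegWt n) (1, 1) :=
  IsWeightedHomogeneous.sum _ _ _ fun i _ =>
    (isWeightedHomogeneous_X ℂ (bidegWt n) (Sum.inl i)).mul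
      (isWeightedHomogeneous_X ℂ (bidegWt n) (Sum.inr i))

theorem pderiv_inl_normSqPoly (i : Fin n) :
    pderiv (Sum.inl i) (normSqPoly n) = X (Sum.inr i) := by
  simp [normSqPoly, Derivation.leibniz, pderiv_X, Pi.single_apply]

theorem pderiv_inr_normSqPoly (i : Fin n) :
    pderiv (Sum.inr i) (normSqPoly n) = X (Sum.inl i) := by
  simp [normSqPoly, Derivation.leibniz, pderiv_X, Pi.single_apply]

theorem kohnLap_normSqPoly_mul {p q : ℕ} {f : MvPolynomial (Var n) ℂ}
    (hf : f.IsWeightedHomogeneous (bidegWt n) (p, q)) :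
    kohnLap n (normSqPoly n * f) = normSqPoly n * kohnLap n f + (p + q + n) • f := by
  have h (i : Fin n) : pderiv (Sum.inl i) (pderiv (Sum.inr i) (normSqPoly n * f)) =
      normSqPoly n * pderiv (Sum.inl i) (pderiv (Sum.inr i) f) +
        (X (Sum.inl i) * pderiv (Sum.inl i) f + X (Sum.inr i) * pderiv (Sum.inr i) f + f) := by
    simp only [Derivation.leibniz, map_add, pderiv_inl_normSqPoly, pderiv_inr_normSqPoly,
      smul_eq_mul, pderiv_X_self]
    ring
  simp only [kohnLap_apply, h, Finset.sum_add_distrib, Finset.mul_sum, sum_X_inl_mul_pderiv hf,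
    sum_X_inr_mul_pderiv hf]
  simp [add_smul]

theorem isWeightedHomogeneous_normSqPoly_pow_mul {p q : ℕ} (m : ℕ) {f : MvPolynomial (Var n) ℂ}
    (hf : f.IsWeightedHomogeneous (bidegWt n) (p, q)) :
    (normSqPoly n ^ m * f).IsWeightedHomogeneous (bidegWt n) (p + m, q + m) := by
  have := (isWeightedHomogeneous_normSqPoly.pow m).mul hf
  simpa [add_comm] using this

theorem kohnLap_normSqPoly_pow_mul {p q : ℕ} (m : ℕ) {f : MvPolynomial (Var n) ℂ}
    (hf : f.IsWeightedHomogeneous (bidegWt n) (p, q)) :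
    kohnLap n (normSqPoly n ^ (m + 1) * f) = normSqPoly n ^ (m + 1) * kohnLap n f +
      ((m + 1) * (p + q + n + m)) • (normSqPoly n ^ m * f) := by
  induction m with
  | zero => simpa using kohnLap_normSqPoly_mul hf
  | succ m ih =>
    rw [pow_succ', mul_assoc, kohnLap_normSqPoly_mul
      (isWeightedHomogeneous_normSqPoly_pow_mul (m + 1) hf), ih]
    simp only [nsmul_eq_mul]
    push_cast
    ring

/-- The Laplacian maps polynomials of bidegree `(p + 1, q + 1)` onto those of bidegree
`(p, q)`. -/
theorem exists_kohnLap_eq (hn : 0 < n) {p q : ℕ} (m : ℕ) {f : MvPolynomial (Var n) ℂ}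
    (hf : f.IsWeightedHomogeneous (bidegWt n) (p, q)) :
    ∃ u : MvPolynomial (Var n) ℂ,
      u.IsWeightedHomogeneous (bidegWt n) (p + m + 1, q + m + 1) ∧
        kohnLap n u = normSqPoly n ^ m * f := by
  have key (p q m : ℕ) (f : MvPolynomial (Var n) ℂ)
      (hf : f.IsWeightedHomogeneous (bidegWt n) (p, q))
      (h : ∃ u : MvPolynomial (Var n) ℂ,
        u.IsWeightedHomogeneous (bidegWt n) (p + m + 1, q + m + 1) ∧
          kohnLap n u = normSqPoly n ^ (m + 1) * kohnLap n f) :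
      ∃ u : MvPolynomial (Var n) ℂ,
        u.IsWeightedHomogeneous (bidegWt n) (p + m + 1, q + m + 1) ∧
          kohnLap n u = normSqPoly n ^ m * f := by
    obtain ⟨u, hu, hu'⟩ := h
    set c : ℂ := (((m + 1) * (p + q + n + m) : ℕ) : ℂ) with hc
    have hc0 : c ≠ 0 := by
      rw [hc]
      exact Nat.cast_ne_zero.2 (by positivity)
    refine ⟨c⁻¹ • (normSqPoly n ^ (m + 1) * f - u), ?_, ?_⟩
    · exact Submodule.smul_mem (weightedHomogeneousSubmodule ℂ (bidegWt n) _) _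
        (Submodule.sub_mem _ (isWeightedHomogeneous_normSqPoly_pow_mul (m + 1) hf) hu)
    · rw [map_smul, map_sub, kohnLap_normSqPoly_pow_mul m hf, hu', add_sub_cancel_left,
        ← Nat.cast_smul_eq_nsmul ℂ, smul_smul, ← hc, inv_mul_cancel₀ hc0, one_smul]
  induction p generalizing q m f with
  | zero =>
    exact key 0 q m f hf ⟨0, isWeightedHomogeneous_zero _ _ _, by
      rw [kohnLap_eq_zero (Or.inl rfl) hf]; simp⟩
  | succ p ih =>
    rcases q with _ | q
    · exact key (p + 1) 0 m f hf ⟨0, isWeightedHomogeneous_zero _ _ _, by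
        rw [kohnLap_eq_zero (Or.inr rfl) hf]; simp⟩
    · refine key (p + 1) (q + 1) m f hf ?_
      obtain ⟨u, hu, hu'⟩ := ih (m + 1) (isWeightedHomogeneous_kohnLap hf)
      exact ⟨u, by convert hu using 2 <;> ring, hu'⟩

end Bidegree

/-- The polynomials of bidegree `(p, q)`. -/
abbrev bidegSubmodule (n p q : ℕ) : Submodule ℂ (MvPolynomial (Var n) ℂ) :=
  weightedHomogeneousSubmodule ℂ (bidegWt n) (p, q)

/-- Exponents of bidegree `(p, q)` are pairs of exponents of degrees `p` and `q`. -/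
def bidegExponentEquiv (n p q : ℕ) :
    {d : Var n →₀ ℕ | Finsupp.weight (bidegWt n) d = (p, q)} ≃
      (Finset.univ : Finset (Fin n)).finsuppAntidiag p ×
        (Finset.univ : Finset (Fin n)).finsuppAntidiag q :=
  (Finsupp.sumFinsuppEquivProdFinsupp.subtypeEquiv
    (p := (· ∈ {d : Var n →₀ ℕ | Finsupp.weight (bidegWt n) d = (p, q)}))
    (q := fun x => x.1 ∈ (Finset.univ : Finset (Fin n)).finsuppAntidiag p ∧
      x.2 ∈ (Finset.univ : Finset (Fin n)).finsuppAntidiag q)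
    (fun d => by simp [weight_bidegWt]; rfl)).trans
    (Equiv.subtypeProdEquivProd
      (p := (· ∈ (Finset.univ : Finset (Fin n)).finsuppAntidiag p))
      (q := (· ∈ (Finset.univ : Finset (Fin n)).finsuppAntidiag q)))

/-- The monomial basis of the polynomials of bidegree `(p, q)`. -/
def bidegBasis (n p q : ℕ) : Module.Basis
    ((Finset.univ : Finset (Fin n)).finsuppAntidiag p ×
        (Finset.univ : Finset (Fin n)).finsuppAntidiag q) ℂ (bidegSubmodule n p q) :=
  ((basisRestrictSupport ℂ {d : Var n →₀ ℕ | Finsupp.weight (bidegWt n) d = (p, q)}).map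
    (LinearEquiv.ofEq _ _
      (weightedHomogeneousSubmodule_eq_finsupp_supported ℂ (bidegWt n) (p, q)).symm)).reindex
    (bidegExponentEquiv n p q)

theorem coe_bidegBasis {n p q : ℕ} (x) : (bidegBasis n p q x : MvPolynomial (Var n) ℂ) =
    (∏ i, X (Sum.inl i) ^ (x.1 : Fin n →₀ ℕ) i) * ∏ i, X (Sum.inr i) ^ (x.2 : Fin n →₀ ℕ) i := by
  have h : (bidegBasis n p q x : MvPolynomial (Var n) ℂ) =
      monomial (((bidegExponentEquiv n p q).symm x : _) : Var n →₀ ℕ) 1 := by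
    rw [bidegBasis, Module.Basis.reindex_apply, Module.Basis.map_apply]
    exact congrArg AddMonoidAlgebra.ofCoeff (Finsupp.supportedEquivFinsupp_symm_single _ _ _)
  rw [h, monomial_eq, Finsupp.prod_fintype _ _ (by simp), Fintype.prod_sum_type]
  simp [bidegExponentEquiv]
  rfl

instance (n p q : ℕ) : Module.Finite ℂ (bidegSubmodule n p q) :=
  Module.Finite.of_basis (bidegBasis n p q)

/-- The substitution `linSubst A B` on polynomials of bidegree `(p, q)`. -/
def bidegSubst {n : ℕ} (p q : ℕ) (A B : Matrix (Fin n) (Fin n) ℂ) :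
    Module.End ℂ (bidegSubmodule n p q) :=
  (linSubst A B).toLinearMap.restrict fun _ hf => isWeightedHomogeneous_linSubst A B hf

section bidegSubst

variable {n p q : ℕ}

@[simp]
theorem coe_bidegSubst (A B : Matrix (Fin n) (Fin n) ℂ) (f : bidegSubmodule n p q) :
    (bidegSubst p q A B f : MvPolynomial (Var n) ℂ) = linSubst A B f :=
  rfl

theorem bidegSubst_mul (A B A' B' : Matrix (Fin n) (Fin n) ℂ) :
    bidegSubst p q A B * bidegSubst p q A' B' = bidegSubst p q (A' * A) (B' * B) := by
  ext1 f
  refine Subtype.ext ?_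
  simp [← linSubst_comp]

theorem bidegSubst_diagonal_bidegBasis (μ ν : Fin n → ℂ) (x) :
    bidegSubst p q (Matrix.diagonal μ) (Matrix.diagonal ν) (bidegBasis n p q x) =
      ((∏ i, μ i ^ (x.1 : Fin n →₀ ℕ) i) * ∏ i, ν i ^ (x.2 : Fin n →₀ ℕ) i) •
        bidegBasis n p q x := by
  refine Subtype.ext ?_
  have h1 (i : Fin n) : linSubst (Matrix.diagonal μ) (Matrix.diagonal ν) (X (Sum.inl i)) =
      MvPolynomial.C (μ i) * X (Sum.inl i) := by
    rw [linSubst_X_inl, Finset.sum_eq_single i] <;> simp +contextual [Matrix.diagonal_apply_ne']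
  have h2 (i : Fin n) : linSubst (Matrix.diagonal μ) (Matrix.diagonal ν) (X (Sum.inr i)) =
      MvPolynomial.C (ν i) * X (Sum.inr i) := by
    rw [linSubst_X_inr, Finset.sum_eq_single i] <;> simp +contextual [Matrix.diagonal_apply_ne']
  rw [coe_bidegSubst, Submodule.coe_smul, coe_bidegBasis, MvPolynomial.smul_eq_C_mul]
  simp only [map_mul, map_prod, map_pow, h1, h2, mul_pow, Finset.prod_mul_distrib]
  ring

theorem sum_finsuppAntidiag_prod_pow (μ : Fin n → ℂ) (m : ℕ) :
    ∑ x : (Finset.univ : Finset (Fin n)).finsuppAntidiag m, ∏ i, μ i ^ (x : Fin n →₀ ℕ) i =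
      completeHom (Finset.univ.val.map μ) m := by
  rw [completeHom, Multiset.map_map]
  change _ = PowerSeries.coeff m (∏ i, geomSeries (μ i))
  rw [PowerSeries.coeff_prod, Finset.sum_coe_sort (Finset.univ.finsuppAntidiag m)
    fun x : Fin n →₀ ℕ => ∏ i, μ i ^ x i]
  simp [geomSeries]

theorem trace_bidegSubst_diagonal (μ ν : Fin n → ℂ) :
    LinearMap.trace ℂ _ (bidegSubst p q (Matrix.diagonal μ) (Matrix.diagonal ν)) =
      completeHom (Finset.univ.val.map μ) p * completeHom (Finset.univ.val.map ν) q := by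
  classical
  rw [LinearMap.trace_eq_matrix_trace ℂ (bidegBasis n p q), Matrix.trace]
  simp only [Matrix.diag_apply, LinearMap.toMatrix_apply, bidegSubst_diagonal_bidegBasis, map_smul,
    Finsupp.smul_apply, Module.Basis.repr_self, Finsupp.single_eq_same, smul_eq_mul, mul_one]
  rw [Fintype.sum_prod_type, ← sum_finsuppAntidiag_prod_pow, ← sum_finsuppAntidiag_prod_pow,
    Finset.sum_mul_sum]

theorem trace_bidegSubst_conj {P Q P' Q' : Matrix (Fin n) (Fin n) ℂ} (h : Q * P = 1)
    (h' : Q' * P' = 1) (A B : Matrix (Fin n) (Fin n) ℂ) :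
    LinearMap.trace ℂ _ (bidegSubst p q (P * A * Q) (P' * B * Q')) =
      LinearMap.trace ℂ _ (bidegSubst p q A B) := by
  rw [← bidegSubst_mul Q Q', LinearMap.trace_mul_comm, bidegSubst_mul, ← mul_assoc, ← mul_assoc,
    h, h', one_mul, one_mul]

end bidegSubst

/-- The action of a group of unitary matrices on the polynomials of bidegree `(p, q)`. -/
def bidegRep {n : ℕ} (p q : ℕ) (G : Subgroup (Matrix.unitaryGroup (Fin n) ℂ)) :
    Representation ℂ G (bidegSubmodule n p q) where
  toFun g := bidegSubst p q (((g : Matrix.unitaryGroup (Fin n) ℂ)⁻¹ :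
      Matrix.unitaryGroup (Fin n) ℂ) : Matrix (Fin n) (Fin n) ℂ)
    ((((g : Matrix.unitaryGroup (Fin n) ℂ)⁻¹ :
      Matrix.unitaryGroup (Fin n) ℂ) : Matrix (Fin n) (Fin n) ℂ).map (starRingEnd ℂ))
  map_one' := by
    ext1 f
    exact Subtype.ext (congrArg (fun φ : _ →ₐ[ℂ] _ => φ (f : MvPolynomial (Var n) ℂ)) uAct_one)
  map_mul' g h := by
    ext1 f
    exact Subtype.ext (uAct_uAct _ _ _).symm

theorem Representation.averageMap_eq {k G V : Type*} [Field k] [Group G] [Fintype G]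
    [Invertible (Fintype.card G : k)] [AddCommGroup V] [Module k V] (ρ : Representation k G V) :
    ρ.averageMap = ⅟(Fintype.card G : k) • ∑ g, ρ g := by
  simp [GroupAlgebra.average, map_sum]

section bidegRep

variable {n : ℕ} (p q : ℕ) (G : Subgroup (Matrix.unitaryGroup (Fin n) ℂ))

@[simp]
theorem coe_bidegRep (g : G) (f : bidegSubmodule n p q) :
    (bidegRep p q G g f : MvPolynomial (Var n) ℂ) = uAct n g f :=
  rfl

/-- The Laplacian from bidegree `(p + 1, q + 1)` to bidegree `(p, q)`. -/
def bidegLap (n p q : ℕ) : bidegSubmodule n (p + 1) (q + 1) →ₗ[ℂ] bidegSubmodule n p q :=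
  (kohnLap n).restrict fun _ hf => isWeightedHomogeneous_kohnLap hf

theorem bidegLap_surjective (hn : 0 < n) : Function.Surjective (bidegLap n p q) := by
  intro f
  obtain ⟨u, hu, h⟩ := exists_kohnLap_eq hn 0 f.2
  exact ⟨⟨u, hu⟩, Subtype.ext (by rw [pow_zero, one_mul] at h; exact h)⟩

theorem bidegLap_bidegRep (g : G) (f : bidegSubmodule n (p + 1) (q + 1)) :
    bidegLap n p q (bidegRep (p + 1) (q + 1) G g f) = bidegRep p q G g (bidegLap n p q f) :=
  Subtype.ext (kohnLap_uAct _ _)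

theorem mem_HpqInv {f : MvPolynomial (Var n) ℂ} :
    f ∈ HpqInv n p q (G : Set (Matrix.unitaryGroup (Fin n) ℂ)) ↔
      (f ∈ bidegSubmodule n p q ∧ kohnLap n f = 0) ∧ ∀ g ∈ G, uAct n g f = f := by
  simp [HpqInv, Hpq, Submodule.mem_iInf, sub_eq_zero]

theorem dimHpqInv_eq_finrank_invariants (hpq : p = 0 ∨ q = 0) :
    dimHpqInv n p q (G : Set (Matrix.unitaryGroup (Fin n) ℂ)) =
      Module.finrank ℂ (bidegRep p q G).invariants := by
  have : HpqInv n p q (G : Set (Matrix.unitaryGroup (Fin n) ℂ)) =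
      (bidegRep p q G).invariants.map (bidegSubmodule n p q).subtype := by
    ext f
    simp only [mem_HpqInv, Submodule.mem_map, Representation.mem_invariants, Subtype.ext_iff,
      coe_bidegRep, Submodule.subtype_apply, Subtype.exists, Subtype.forall]
    constructor
    · rintro ⟨⟨h1, -⟩, h2⟩
      exact ⟨f, h1, h2, rfl⟩
    · rintro ⟨f, h1, h2, rfl⟩
      exact ⟨⟨h1, kohnLap_eq_zero hpq h1⟩, h2⟩
  rw [dimHpqInv, this]
  exact Submodule.finrank_map_subtype_eq _ _

theorem dimHpqInv_succ_add [Finite G] (hn : 0 < n) :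
    dimHpqInv n (p + 1) (q + 1) (G : Set (Matrix.unitaryGroup (Fin n) ℂ)) +
        Module.finrank ℂ (bidegRep p q G).invariants =
      Module.finrank ℂ (bidegRep (p + 1) (q + 1) G).invariants := by
  have := Fintype.ofFinite G
  have : Invertible (Fintype.card G : ℂ) := invertibleOfNonzero (by simp)
  let L := (bidegLap n p q).domRestrict (bidegRep (p + 1) (q + 1) G).invariants
  have hker : HpqInv n (p + 1) (q + 1) (G : Set (Matrix.unitaryGroup (Fin n) ℂ)) =
      (L.ker.map (Submodule.subtype _)).map (Submodule.subtype _) := by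
    ext f
    simp only [mem_HpqInv, Submodule.mem_map, Representation.mem_invariants, Subtype.ext_iff,
      coe_bidegRep, Submodule.subtype_apply, Subtype.exists, Subtype.forall, LinearMap.mem_ker, L]
    constructor
    · rintro ⟨⟨h1, h3⟩, h2⟩
      exact ⟨f, h1, ⟨f, h1, h2, h3, rfl⟩, rfl⟩
    · rintro ⟨_, h1, ⟨_, _, h2, h3, rfl⟩, rfl⟩
      exact ⟨⟨h1, h3⟩, h2⟩
  have hrange : L.range = (bidegRep p q G).invariants := by
    ext f
    constructor
    · rintro ⟨u, rfl⟩ g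
      change bidegRep p q G g (bidegLap n p q u) = bidegLap n p q u
      rw [← bidegLap_bidegRep, u.2 g]
    · intro hf
      obtain ⟨u, rfl⟩ := bidegLap_surjective p q hn f
      refine ⟨⟨_, (bidegRep (p + 1) (q + 1) G).averageMap_invariant u⟩, ?_⟩
      change bidegLap n p q ((bidegRep (p + 1) (q + 1) G).averageMap u) = _
      conv_rhs => rw [← (bidegRep p q G).averageMap_id _ hf]
      simp only [Representation.averageMap_eq, LinearMap.smul_apply, LinearMap.sum_apply,
        map_smul, map_sum, bidegLap_bidegRep]
  have hdim : dimHpqInv n (p + 1) (q + 1) (G : Set (Matrix.unitaryGroup (Fin n) ℂ)) =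
      Module.finrank ℂ L.ker := by
    unfold dimHpqInv
    rw [hker]
    exact (Submodule.finrank_map_subtype_eq (bidegSubmodule n (p + 1) (q + 1)) _).trans
      (Submodule.finrank_map_subtype_eq _ _)
  have hsum := LinearMap.finrank_range_add_finrank_ker (K := ℂ)
    (V := (bidegRep (p + 1) (q + 1) G).invariants) (V₂ := bidegSubmodule n p q) L
  rwa [hrange, add_comm, ← hdim] at hsum

theorem finrank_invariants_bidegRep [Fintype G] :
    (Module.finrank ℂ (bidegRep p q G).invariants : ℂ) =
      (Fintype.card G : ℂ)⁻¹ * ∑ g : G, LinearMap.trace ℂ _ (bidegRep p q G g) := by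
  have : Invertible (Fintype.card G : ℂ) := invertibleOfNonzero (by simp)
  have h1 : Module.Free ℂ (bidegRep p q G).invariants :=
    Module.Free.of_divisionRing ℂ (bidegRep p q G).invariants
  have h2 : Module.Free ℂ (bidegRep p q G).averageMap.ker :=
    Module.Free.of_divisionRing ℂ (bidegRep p q G).averageMap.ker
  rw [← (bidegRep p q G).isProj_averageMap.trace, Representation.averageMap_eq, map_smul, map_sum,
    invOf_eq_inv, smul_eq_mul]

/-- A unitary matrix of finite order acts on polynomials with eigenvalues read off from those of
its inverse. -/
theorem exists_trace_bidegRep [Finite G] (g : G) :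
    ∃ μ : Fin n → ℂ, (∀ i, ‖μ i‖ = 1) ∧ ((∀ i, μ i = 1) ↔ g = 1) ∧
      ∀ p q, LinearMap.trace ℂ _ (bidegRep p q G g) =
        completeHom (Finset.univ.val.map μ) p *
          completeHom (Finset.univ.val.map fun i => starRingEnd ℂ (μ i)) q := by
  set A : Matrix (Fin n) (Fin n) ℂ := (((g : Matrix.unitaryGroup (Fin n) ℂ)⁻¹ :
      Matrix.unitaryGroup (Fin n) ℂ) : Matrix (Fin n) (Fin n) ℂ) with hA
  have hA1 : A = 1 ↔ g = 1 := by
    rw [hA, ← Subtype.coe_inj (a := g), OneMemClass.coe_one, ← inv_eq_one (a := g.1),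
      ← Subtype.coe_inj (a := (g.1)⁻¹)]
    rfl
  have hpow : A ^ Nat.card G = 1 := by
    have h1 : (g⁻¹ : G) ^ Nat.card G = 1 := pow_card_eq_one'
    exact congrArg (fun x : G => ((x : Matrix.unitaryGroup (Fin n) ℂ) :
      Matrix (Fin n) (Fin n) ℂ)) h1
  obtain ⟨P, Q, μ, hPQ, hQP, hdiag, hμ⟩ := exists_diagonalization Nat.card_pos hpow
  refine ⟨μ, hμ, ?_, fun p q => ?_⟩
  · rw [← hA1]
    constructor
    · intro h
      have : μ = fun _ => 1 := funext h
      rw [hdiag, this, Matrix.diagonal_one, mul_one, hPQ]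
    · intro h i
      have h1 : Matrix.diagonal μ = 1 := by
        calc Matrix.diagonal μ = (Q * P) * Matrix.diagonal μ * (Q * P) := by simp [hQP]
          _ = Q * A * P := by rw [hdiag]; simp only [mul_assoc]
          _ = 1 := by rw [h, mul_one, hQP]
      simpa using congrFun (congrFun h1 i) i
  · have h1 : A.map (starRingEnd ℂ) = P.map (starRingEnd ℂ) *
        Matrix.diagonal (fun i => starRingEnd ℂ (μ i)) * Q.map (starRingEnd ℂ) := by
      rw [hdiag, Matrix.map_mul, Matrix.map_mul, Matrix.diagonal_map (map_zero _)]
    have h2 : Q.map (starRingEnd ℂ) * P.map (starRingEnd ℂ) = 1 := by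
      rw [← Matrix.map_mul, hQP, Matrix.map_one _ (map_zero _) (map_one _)]
    change LinearMap.trace ℂ _ (bidegSubst p q A (A.map (starRingEnd ℂ))) = _
    rw [h1]
    conv_lhs => rw [hdiag]
    rw [trace_bidegSubst_conj hQP h2, trace_bidegSubst_diagonal]

end bidegRep

theorem exists_dimHpqInv_eq_sum_traceHpq {n : ℕ} (hn : 0 < n)
    (G : Subgroup (Matrix.unitaryGroup (Fin n) ℂ)) [Fintype G] :
    ∃ μ : G → Fin n → ℂ, (∀ g i, ‖μ g i‖ = 1) ∧ (∀ g, (∀ i, μ g i = 1) ↔ g = 1) ∧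
      ∀ p q, (dimHpqInv n p q (G : Set (Matrix.unitaryGroup (Fin n) ℂ)) : ℂ) =
        (Fintype.card G : ℂ)⁻¹ * ∑ g : G, traceHpq (Finset.univ.val.map (μ g))
          (Finset.univ.val.map fun i => starRingEnd ℂ (μ g i)) p q := by
  choose μ h1 h2 h3 using exists_trace_bidegRep G
  refine ⟨μ, h1, h2, fun p q => ?_⟩
  by_cases hpq : p = 0 ∨ q = 0
  · rw [dimHpqInv_eq_finrank_invariants p q G hpq, finrank_invariants_bidegRep]
    simp only [traceHpq, hpq, if_true, sub_zero, h3]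
  · obtain ⟨p, rfl⟩ := Nat.exists_eq_succ_of_ne_zero (not_or.1 hpq).1
    obtain ⟨q, rfl⟩ := Nat.exists_eq_succ_of_ne_zero (not_or.1 hpq).2
    have h := congrArg (Nat.cast : ℕ → ℂ) (dimHpqInv_succ_add p q G hn)
    rw [Nat.cast_add, finrank_invariants_bidegRep, finrank_invariants_bidegRep,
      ← eq_sub_iff_add_eq, ← mul_sub, ← Finset.sum_sub_distrib] at h
    simp only [Nat.succ_eq_add_one, h, traceHpq, h3, hpq, if_false, add_tsub_cancel_right]

theorem countN_eq_sum (k : ℕ) (S : Set (Matrix.unitaryGroup (Fin (k + 2)) ℂ)) {lam : ℝ}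
    (hlam : 0 ≤ lam) :
    countN (k + 2) S lam = ∑ i ∈ Finset.range (⌊lam⌋₊ + 1), ∑ j ∈ Finset.range (⌊lam⌋₊ + 1),
      if 2 * (j + 1) * (i + (k + 1)) ≤ ⌊lam⌋₊ then dimHpqInv (k + 2) i (j + 1) S else 0 := by
  rw [countN, Finset.sum_filter, Finset.sum_product]
  refine Finset.sum_congr rfl fun i _ => ?_
  simp only [← Nat.le_floor_iff hlam, show i + (k + 2) - 1 = i + (k + 1) by omega]
  rw [Finset.sum_range_succ', Finset.sum_range_succ]
  have h : ¬ 2 * (⌊lam⌋₊ + 1) * (i + (k + 1)) ≤ ⌊lam⌋₊ := by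
    have : (⌊lam⌋₊ + 1) * 1 ≤ (⌊lam⌋₊ + 1) * (i + (k + 1)) := Nat.mul_le_mul_left _ (by omega)
    rw [mul_assoc]
    omega
  rw [if_neg h]
  simp

theorem tendsto_sum_traceHpq_eigenvalues {k : ℕ} {μ : Fin (k + 2) → ℂ} (hμ : ∀ i, ‖μ i‖ = 1) :
    Tendsto (fun K : ℕ => (∑ i ∈ Finset.range (K + 1), ∑ j ∈ Finset.range (K + 1),
        if 2 * (j + 1) * (i + (k + 1)) ≤ K then
          traceHpq (Finset.univ.val.map μ)
            (Finset.univ.val.map fun i => starRingEnd ℂ (μ i)) i (j + 1) else 0) / (K : ℂ) ^ (k + 2))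
      atTop (nhds (if ∀ i, μ i = 1 then
        ((1 / ((k + 2).factorial * 2 ^ (k + 2)) *
          ((∑' j : ℕ, ((j + 1 + k).choose k : ℝ) / ((j + 1 : ℕ) : ℝ) ^ (k + 2)) +
            ∑' j : ℕ, ((j + k).choose k : ℝ) / ((j + (k + 1) : ℕ) : ℝ) ^ (k + 2)) : ℝ) : ℂ)
        else 0)) := by
  have hcons (ν : Fin (k + 2) → ℂ) :
      Finset.univ.val.map ν = ν 0 ::ₘ Finset.univ.val.map (Fin.tail ν) := by
    rw [Fin.univ_val_map, Fin.univ_val_map, List.ofFn_succ]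
    rfl
  have hmem (ν : Fin (k + 2) → ℂ) (a : ℂ) :
      a ∈ ν 0 ::ₘ Finset.univ.val.map (Fin.tail ν) ↔ ∃ i, ν i = a := by
    rw [← hcons, Multiset.mem_map]; simp only [Finset.mem_val, Finset.mem_univ, true_and]
  have huv : μ 0 * starRingEnd ℂ (μ 0) = 1 := by
    rw [Complex.mul_conj, Complex.normSq_eq_norm_sq, hμ]; simp
  have h := tendsto_sum_traceHpq huv
    (s := Finset.univ.val.map (Fin.tail μ))
    (t := Finset.univ.val.map (Fin.tail fun i => starRingEnd ℂ (μ i))) (k := k)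
    (by simp) (by simp)
    (fun a ha => by obtain ⟨i, rfl⟩ := (hmem μ a).1 ha; exact (hμ i).le)
    (fun a ha => by
      obtain ⟨i, rfl⟩ := (hmem (fun i => starRingEnd ℂ (μ i)) a).1 ha
      rw [RCLike.norm_conj]; exact (hμ i).le)
  rw [← hcons μ] at h
  have hcons' := hcons fun i => starRingEnd ℂ (μ i)
  rw [← hcons'] at h
  convert h using 2
  have e1 : (∀ a ∈ Finset.univ.val.map μ, a = 1) ↔ ∀ i, μ i = 1 := by
    simp only [Multiset.mem_map, Finset.mem_val, Finset.mem_univ, true_and, forall_exists_index,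
      forall_apply_eq_imp_iff]
  have e2 : (∀ a ∈ Finset.univ.val.map fun i => starRingEnd ℂ (μ i), a = 1) ↔ ∀ i, μ i = 1 := by
    simp only [Multiset.mem_map, Finset.mem_val, Finset.mem_univ, true_and, forall_exists_index,
      forall_apply_eq_imp_iff, map_eq_one_iff _ (starRingEnd ℂ).injective]
  simp only [e1, e2]
  split_ifs with h1
  · have hs : Finset.univ.val.map (Fin.tail μ) = Multiset.replicate (k + 1) 1 :=
      Multiset.eq_replicate.2 ⟨by simp, by simp [Fin.tail, h1]⟩
    have ht : Finset.univ.val.map (Fin.tail fun i => starRingEnd ℂ (μ i)) =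
        Multiset.replicate (k + 1) 1 :=
      Multiset.eq_replicate.2 ⟨by simp, by simp [Fin.tail, h1]⟩
    rw [hs, ht, h1, map_one, one_mul]
    simp only [completeHom_replicate_one]
    push_cast
    rw [mul_add, ← tsum_mul_left, ← tsum_mul_left]
    congr 1 <;> refine tsum_congr fun j => ?_
    · rw [div_pow, mul_pow, one_pow]
      field_simp
    · rw [div_pow, mul_pow, one_pow]
      field_simp
  · simp

theorem tendsto_countN {k : ℕ} (G : Subgroup (Matrix.unitaryGroup (Fin (k + 2)) ℂ)) [Finite G] :
    Tendsto (fun lam : ℝ => (countN (k + 2) (G : Set (Matrix.unitaryGroup (Fin (k + 2)) ℂ)) lam : ℝ)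
        / lam ^ (k + 2)) atTop
      (nhds ((Nat.card G : ℝ)⁻¹ * (1 / ((k + 2).factorial * 2 ^ (k + 2)) *
          ((∑' j : ℕ, ((j + 1 + k).choose k : ℝ) / ((j + 1 : ℕ) : ℝ) ^ (k + 2)) +
            ∑' j : ℕ, ((j + k).choose k : ℝ) / ((j + (k + 1) : ℕ) : ℝ) ^ (k + 2))))) := by
  have := Fintype.ofFinite G
  obtain ⟨μ, hμ, hμ1, hdim⟩ := exists_dimHpqInv_eq_sum_traceHpq (Nat.succ_pos (k + 1)) G
  set c : ℝ := 1 / ((k + 2).factorial * 2 ^ (k + 2)) *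
    ((∑' j : ℕ, ((j + 1 + k).choose k : ℝ) / ((j + 1 : ℕ) : ℝ) ^ (k + 2)) +
      ∑' j : ℕ, ((j + k).choose k : ℝ) / ((j + (k + 1) : ℕ) : ℝ) ^ (k + 2)) with hc
  set N : ℕ → ℕ := fun K => ∑ i ∈ Finset.range (K + 1), ∑ j ∈ Finset.range (K + 1),
      if 2 * (j + 1) * (i + (k + 1)) ≤ K then
        dimHpqInv (k + 2) i (j + 1) (G : Set (Matrix.unitaryGroup (Fin (k + 2)) ℂ)) else 0 with hN
  have hlim : Tendsto (fun K : ℕ => (N K : ℂ) / (K : ℂ) ^ (k + 2)) atTop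
      (nhds (((Nat.card G : ℝ)⁻¹ * c : ℝ) : ℂ)) := by
    have h := (tendsto_finsetSum Finset.univ fun (g : G) _ =>
      tendsto_sum_traceHpq_eigenvalues (hμ g)).const_mul (Fintype.card G : ℂ)⁻¹
    simp only [hμ1, Finset.sum_ite_eq', Finset.mem_univ, if_true, ← hc] at h
    refine (h.congr fun K => ?_).trans_eq ?_
    · rw [← Finset.sum_div, mul_div_assoc', hN]
      congr 1
      rw [Finset.sum_comm, Finset.mul_sum, Nat.cast_sum]
      refine Finset.sum_congr rfl fun i _ => ?_
      rw [Finset.sum_comm, Finset.mul_sum, Nat.cast_sum]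
      refine Finset.sum_congr rfl fun j _ => ?_
      split_ifs
      · exact (hdim i (j + 1)).symm
      · simp
    · push_cast [Nat.card_eq_fintype_card]
      rfl
  have hlim' : Tendsto (fun K : ℕ => (N K : ℝ) / (K : ℝ) ^ (k + 2)) atTop
      (nhds ((Nat.card G : ℝ)⁻¹ * c)) := by
    refine ((Complex.continuous_re.tendsto _).comp hlim).congr fun K => ?_
    simp only [Function.comp_apply]
    rw [← Complex.ofReal_natCast, ← Complex.ofReal_natCast, ← Complex.ofReal_pow,
      ← Complex.ofReal_div, Complex.ofReal_re]
  have hfl : Tendsto (fun lam : ℝ => ((⌊lam⌋₊ : ℝ) / lam) ^ (k + 2)) atTop (nhds 1) := by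
    simpa using (tendsto_nat_floor_div_atTop (R := ℝ)).pow (k + 2)
  have := (hlim'.comp (tendsto_nat_floor_atTop (α := ℝ))).mul hfl
  rw [mul_one] at this
  refine this.congr' ?_
  filter_upwards [eventually_ge_atTop (1 : ℝ)] with lam hlam
  have h0 : (⌊lam⌋₊ : ℝ) ≠ 0 := Nat.cast_ne_zero.2 (Nat.floor_pos.2 hlam).ne'
  rw [countN_eq_sum k _ (by linarith), Function.comp_apply, div_pow]
  field_simp
  rfl

/-- Weyl-type law for the Kohn Laplacian on sphere quotients. -/
theorem weyl_law_sphere_quotient (n : ℕ) (hn : 2 ≤ n)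
    (G : Subgroup (Matrix.unitaryGroup (Fin n) ℂ)) (hGfin : Finite G) :
    Filter.Tendsto (fun lam : ℝ => (countN n (G : Set _) lam : ℝ) / lam ^ n)
      Filter.atTop
      (nhds ((2 * Real.pi ^ n / Real.Gamma n / (Nat.card G)) *
        (((n : ℝ) - 1) / (n * (2 * Real.pi) ^ n * Real.Gamma ((n : ℝ) + 1)) *
          ∫ τ : ℝ, (τ / Real.sinh τ) ^ n * Real.exp (-((n : ℝ) - 2) * τ)))) := by
  obtain ⟨k, rfl⟩ := Nat.exists_eq_add_of_le' hn
  have hG1 : Real.Gamma ((k + 2 : ℕ) : ℝ) = (k + 1).factorial := by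
    have := Real.Gamma_nat_eq_factorial (k + 1)
    push_cast at this ⊢
    rw [← this]
    congr 1
    ring
  have hexp : -(((k + 2 : ℕ) : ℝ) - 2) = -(k : ℝ) := by push_cast; ring
  rw [hexp, integral_div_sinh_pow, hG1, Real.Gamma_nat_eq_factorial]
  convert tendsto_countN G using 2
  have hcard : (Nat.card G : ℝ) ≠ 0 := Nat.cast_ne_zero.2 Nat.card_pos.ne'
  have hpi := Real.pi_ne_zero
  rw [Nat.factorial_succ (k + 1), mul_pow]
  push_cast
  have h1 : ((k + 1).factorial : ℝ) ≠ 0 := by positivity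
  have h2 : (k : ℝ) + 1 ≠ 0 := by positivity
  field_simp
  ring
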